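/- Let Assumptions (A1) and (A2) hold. There exists a positive constant C₀ such that, if the boundary current J_b and δ₀ are sufficiently small, every solution (p, q, r, V) ∈ H³(0,1) × H²(0,1) × H²(0,1) × H⁵(0,1) of the steady-state perturbation system satisfies ‖p‖²_{H³} + ‖q‖²_{H²} + ‖r‖²_{H²} + ‖V‖²_{H⁵} ≤ C₀ δ₀². -/

import Mathlib

open MeasureTheory Set

noncomputable section

/-- The squared `L²(0,1)` norm of a function. -/
def L2sq (f : ℝ → ℝ) : ℝ := ∫ x in (0:ℝ)..1, (f x) ^ 2

/-- The squared Sobolev `H^k(0,1)` norm of a function (classical derivatives). -/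
def sobSq (k : ℕ) (f : ℝ → ℝ) : ℝ :=
  ∑ i ∈ Finset.range (k + 1), L2sq (iteratedDeriv i f)

/-- `δ₀ = ‖ρ_x‖_{H³(0,1)}`. -/
def delta0 (ρ : ℝ → ℝ) : ℝ := Real.sqrt (sobSq 3 (deriv ρ))

/-- Assumption (A1): `ρ(0) = ρ(1)`, `ρ ∈ C⁴` and `ρ > 0` on `[0,1]`. -/
def AssumpA1 (ρ : ℝ → ℝ) : Prop :=
  ρ 0 = ρ 1 ∧ ContDiff ℝ 4 ρ ∧ ∀ x ∈ Icc (0:ℝ) 1, 0 < ρ x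

/-- Assumption (A2). -/
def AssumpA2 (ν τ lam μ : ℝ) (ρ : ℝ → ℝ) : Prop :=
  ∃ α₀ ∈ Ioo (0:ℝ) 1, ∀ x ∈ Icc (0:ℝ) 1,
    1 / α₀ < Real.sqrt 2 * τ * ν * (2 * μ + 5) * ρ x / (3 * lam ^ 2)

/-- The additional condition (1.6)/(newcond1) of the stability theorem. -/
def NewCond (ν τ lam μ : ℝ) (ρ : ℝ → ℝ) : Prop :=
  ∀ x ∈ Icc (0:ℝ) 1,
    1 < τ * (2 + τ * ν) * (2 * μ + 5) * (μ * ν * lam ^ 2 + ν * ρ x) / (3 * lam ^ 2)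

/-- Membership in `H^k(0,1)` (square-integrability of the classical derivatives). -/
def MemH (k : ℕ) (f : ℝ → ℝ) : Prop :=
  ∀ i ≤ k, IntervalIntegrable (fun x => (iteratedDeriv i f x) ^ 2) volume 0 1

/-- Time derivative of a function of time and space. -/
def tderiv (f : ℝ → ℝ → ℝ) (t x : ℝ) : ℝ := deriv (fun s => f s x) t

/-- Membership in `L²(0,T;H^k(0,1))`. -/
def MemL2H (k : ℕ) (T : ℝ) (f : ℝ → ℝ → ℝ) : Prop :=
  IntervalIntegrable (fun t => sobSq k (f t)) volume 0 T

/-- Membership in `H¹(0,T;H^k(0,1))`. -/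
def MemH1H (k : ℕ) (T : ℝ) (f : ℝ → ℝ → ℝ) : Prop :=
  MemL2H k T f ∧ IntervalIntegrable (fun t => sobSq k (fun x => tderiv f t x)) volume 0 T

/-- Coefficient `a₂` of the steady-state perturbation system. -/
def coefA2 (ν ε τ μ Jb : ℝ) (ρ : ℝ → ℝ) (x : ℝ) : ℝ :=
  -(Jb / τ) - (1 + μ) * deriv ρ x + (2/3) * Jb ^ 2 * deriv ρ x / (ρ x) ^ 2
    + (ε ^ 2 / 18) * (deriv ρ x) ^ 3 / (ρ x) ^ 2

/-- Coefficient `b₂`. -/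
def coefB2 (τ Jb : ℝ) (ρ : ℝ → ℝ) (x : ℝ) : ℝ :=
  1 / τ - (4/3) * Jb * deriv ρ x / (ρ x) ^ 2

/-- Coefficient `c₂`. -/
def coefC2 (ε Jb : ℝ) (ρ : ℝ → ℝ) (x : ℝ) : ℝ :=
  (4/3) * Jb ^ 2 * (deriv ρ x) ^ 2 / (ρ x) ^ 3 - (ε ^ 2 / 9) * (deriv ρ x) ^ 4 / (ρ x) ^ 3

/-- Coefficient `d₂`. -/
def coefD2 (ε μ Jb : ℝ) (ρ : ℝ → ℝ) (x : ℝ) : ℝ :=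
  μ - (2/3) * Jb ^ 2 / (ρ x) ^ 2 - (ε ^ 2 / 6) * (deriv ρ x) ^ 2 / (ρ x) ^ 2

/-- Coefficient `e₂`. -/
def coefE2 (ν ε Jb : ℝ) (ρ : ℝ → ℝ) (x : ℝ) : ℝ :=
  (4/3) * Jb / ρ x - (ε ^ 2 / (9 * ν)) * deriv ρ x / ρ x

/-- Coefficient `a₃`. -/
def coefA3 (ε Jb : ℝ) (ρ : ℝ → ℝ) (x : ℝ) : ℝ :=
  -(2/3) * Jb ^ 3 / (ρ x) ^ 3 + (ε ^ 2 / 9) * Jb * deriv ρ x / (ρ x) ^ 3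

/-- Coefficient `b₃`. -/
def coefB3 (τ Jb : ℝ) (ρ : ℝ → ℝ) (x : ℝ) : ℝ :=
  2 / τ - (5/3) * Jb * deriv ρ x / (ρ x) ^ 2

/-- Coefficient `c₃`. -/
def coefC3 (ε τ Jb : ℝ) (ρ : ℝ → ℝ) (x : ℝ) : ℝ :=
  -(3 / τ) + (5/2) * Jb * (deriv ρ x) ^ 2 / (ρ x) ^ 2 - 2 * Jb ^ 3 * deriv ρ x / (ρ x) ^ 4
    + (ε ^ 2 / 3) * Jb * (deriv ρ x) ^ 4 / (ρ x) ^ 4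

/-- Coefficient `d₃`. -/
def coefD3 (ε Jb : ℝ) (ρ : ℝ → ℝ) (x : ℝ) : ℝ :=
  -(5 * Jb / (2 * ρ x)) - (ε ^ 2 / 3) * Jb * (deriv ρ x) ^ 2 / (ρ x) ^ 3

/-- Coefficient `e₃`. -/
def coefE3 (ν ε μ Jb : ℝ) (ρ : ℝ → ℝ) (x : ℝ) : ℝ :=
  μ + 5/2 - Jb ^ 2 / (ρ x) ^ 2 + (ε ^ 2 / (6 * ν)) * Jb * deriv ρ x / (ρ x) ^ 2
    + (ε ^ 2 / 18) * (deriv ρ x) ^ 2 / (ρ x) ^ 2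

/-- Coefficient `h₃`. -/
def coefH3 (ε Jb : ℝ) (ρ : ℝ → ℝ) (x : ℝ) : ℝ :=
  2 * Jb ^ 2 / (ρ x) ^ 3 - (ε ^ 2 / 9) * (deriv ρ x) ^ 3 / (ρ x) ^ 3

/-- The explicit quadratic remainder `f₂` of the steady-state perturbation system. -/
def f2fun (ν ε Jb : ℝ) (ρ p q V : ℝ → ℝ) (x : ℝ) : ℝ :=
  p x * deriv V x
    - (2/3) * deriv (fun y => (q y + Jb) ^ 2 / (p y + ρ y)) x
    + (ε ^ 2 / 18) * (deriv (fun y => p y + ρ y) x) ^ 3 / (p x + ρ x) ^ 2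
    + (ε ^ 2 / (9 * ν)) * (deriv (fun y => p y + ρ y) x / (p x + ρ x)) * deriv q x
    + (4/3) * (Jb / ρ x) * deriv q x
    - (2/3) * (Jb ^ 2 * deriv ρ x / (ρ x) ^ 2
        - 2 * Jb ^ 2 * (deriv ρ x) ^ 2 / (ρ x) ^ 3 * p x
        + Jb ^ 2 / (ρ x) ^ 2 * deriv p x
        + 2 * Jb * deriv ρ x / (ρ x) ^ 2 * q x)
    - (ε ^ 2 / 18) * (3 * (deriv ρ x) ^ 2 / (ρ x) ^ 2 * deriv p x
        + 2 * (deriv ρ x) ^ 4 / (ρ x) ^ 3 * p x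
        + (deriv ρ x) ^ 3 / (ρ x) ^ 2)
    - (ε ^ 2 / (9 * ν)) * (deriv ρ x / ρ x) * deriv q x

/-- The explicit quadratic remainder `f₃` of the steady-state perturbation system. -/
def f3fun (ν ε Jb : ℝ) (ρ p q r V : ℝ → ℝ) (x : ℝ) : ℝ :=
  q x * deriv V x
    - (5/3) * deriv (fun y => (q y + Jb) / (p y + ρ y) * (r y + (3/2) * ρ y)) x
    + (1/3) * deriv (fun y => (q y + Jb) ^ 3 / (p y + ρ y) ^ 2) x
    + (ε ^ 2 / 18) * deriv (fun y =>
        (q y + Jb) * iteratedDeriv 2 (fun z => p z + ρ z) y / (p y + ρ y)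
          - (q y + Jb) * (deriv (fun z => p z + ρ z) y) ^ 2 / (p y + ρ y) ^ 2) x
    - (ε ^ 2 / (18 * ν)) * (q x + Jb) * iteratedDeriv 2 q x / (p x + ρ x)
    + (5/3) * ((3/2) * Jb * deriv ρ x / ρ x + (3/2) * deriv q x
        + (Jb / ρ x) * deriv r x + (3/2) * (deriv ρ x / ρ x) * q x
        - (3/2) * Jb * (deriv ρ x) ^ 2 / (ρ x) ^ 2 * p x)
    - (5/3) * ((3/2) * Jb * deriv ρ x / ρ x
        - 3 * Jb * (deriv ρ x) ^ 2 / (ρ x) ^ 2 * p x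
        + Jb * deriv ρ x / (ρ x) ^ 2 * r x
        + (3/2) * (deriv ρ x / ρ x) * q x
        + (3/2) * (Jb / ρ x) * deriv p x)
    - (Jb ^ 2 / (ρ x) ^ 2) * deriv q x
    + (2/3) * (Jb ^ 3 / (ρ x) ^ 3 - 3 * Jb ^ 3 * deriv ρ x / (ρ x) ^ 4 * p x
        + 3 * Jb ^ 2 / (ρ x) ^ 3 * q x)
    + (ε ^ 2 / (6 * ν)) * (Jb * deriv ρ x / (ρ x) ^ 2) * deriv q x
    + (ε ^ 2 / 18) * ((deriv ρ x) ^ 2 / (ρ x) ^ 2) * deriv q x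
    - (ε ^ 2 / 9) * (Jb * (deriv ρ x) ^ 3 / (ρ x) ^ 3
        - 3 * Jb * (deriv ρ x) ^ 4 / (ρ x) ^ 4 * p x
        + 3 * Jb * (deriv ρ x) ^ 2 / (ρ x) ^ 3 * deriv p x
        + (deriv ρ x) ^ 3 / (ρ x) ^ 3 * q x)

/-- A (classical) solution of the steady-state perturbation system (2.2). -/
structure IsSteadyPerturbSol (ν ε τ lam μ Jb Vb : ℝ) (ρ p q r V : ℝ → ℝ) : Prop where
  reg_p : ContDiff ℝ 3 p
  reg_q : ContDiff ℝ 2 q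
  reg_r : ContDiff ℝ 2 r
  reg_V : ContDiff ℝ 5 V
  pos : ∀ x ∈ Icc (0:ℝ) 1, 0 < p x + ρ x
  eq1 : ∀ x ∈ Icc (0:ℝ) 1, -ν * iteratedDeriv 2 p x + deriv q x = 0
  eq2 : ∀ x ∈ Icc (0:ℝ) 1,
    -(ν + ε ^ 2 / (18 * ν)) * iteratedDeriv 2 q x + coefB2 τ Jb ρ x * q x
      + coefC2 ε Jb ρ x * p x + coefD2 ε μ Jb ρ x * deriv p x
      + coefE2 ν ε Jb ρ x * deriv q x + (2/3) * deriv r x - ρ x * deriv V x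
      = coefA2 ν ε τ μ Jb ρ x + f2fun ν ε Jb ρ p q V x
  eq3 : ∀ x ∈ Icc (0:ℝ) 1,
    -ν * iteratedDeriv 2 r x + coefB3 τ Jb ρ x * r x + coefC3 ε τ Jb ρ x * p x
      + coefD3 ε Jb ρ x * deriv p x + coefE3 ν ε μ Jb ρ x * deriv q x
      + coefH3 ε Jb ρ x * q x + (5/3) * (Jb / ρ x) * deriv r x - Jb * deriv V x
      = coefA3 ε Jb ρ x + f3fun ν ε Jb ρ p q r V x
        + (ε ^ 2 / (18 * ν)) * iteratedDeriv 2 q x * (q x + Jb) / (p x + ρ x)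
  eq4 : ∀ x ∈ Icc (0:ℝ) 1, -(lam ^ 2) * iteratedDeriv 2 V x + p x = 0
  bc_p : ∀ k : ℕ, k ≤ 3 → iteratedDeriv k p 0 = 0 ∧ iteratedDeriv k p 1 = 0
  bc_q : q 0 = 0 ∧ q 1 = 0
  bc_r : r 0 = 0 ∧ r 1 = 0
  bc_V : deriv V 0 = 0 ∧ deriv V 1 = 0 ∧ V 0 = 0 ∧ V 1 = Vb

theorem hasDerivAt_iteratedDeriv {f : ℝ → ℝ} {n : ℕ} (hf : ContDiff ℝ n f) {k : ℕ} (hk : k < n)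
    (x : ℝ) : HasDerivAt (iteratedDeriv k f) (iteratedDeriv (k + 1) f x) x := by
  rw [iteratedDeriv_succ]
  exact (hf.differentiable_iteratedDeriv k (by exact_mod_cast hk) x).hasDerivAt

theorem hasDerivAt_deriv {f : ℝ → ℝ} {n : ℕ} (hf : ContDiff ℝ n f) (hn : 1 < n) (x : ℝ) :
    HasDerivAt (deriv f) (iteratedDeriv 2 f x) x := by
  simpa only [iteratedDeriv_one] using hasDerivAt_iteratedDeriv hf hn x

theorem deriv_eqOn_Icc {f g : ℝ → ℝ} (hf : Differentiable ℝ f) (hg : Differentiable ℝ g)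
    (h : EqOn f g (Icc 0 1)) : EqOn (deriv f) (deriv g) (Icc 0 1) := by
  intro x hx
  have hu : UniqueDiffWithinAt ℝ (Icc (0:ℝ) 1) x := uniqueDiffOn_Icc zero_lt_one x hx
  rw [← (hf x).derivWithin hu, ← (hg x).derivWithin hu]
  exact derivWithin_congr h (h hx)

theorem L2sq_le_of_abs_le {f : ℝ → ℝ} {c : ℝ} (h : ∀ x ∈ Icc (0:ℝ) 1, |f x| ≤ c) :
    L2sq f ≤ c ^ 2 := by
  have := intervalIntegral.norm_integral_le_of_norm_le_const (a := 0) (b := 1) (C := c ^ 2)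
    (f := fun x => f x ^ 2) (fun x hx => by
      rw [uIoc_of_le zero_le_one] at hx
      rw [Real.norm_eq_abs, abs_pow]
      exact pow_le_pow_left₀ (abs_nonneg _) (h x ⟨hx.1.le, hx.2⟩) 2)
  simp only [sub_zero, abs_one, mul_one] at this
  exact (le_abs_self _).trans this

theorem L2sq_nonneg (f : ℝ → ℝ) : 0 ≤ L2sq f :=
  intervalIntegral.integral_nonneg zero_le_one fun _ _ => sq_nonneg _

theorem sobSq_le_of_abs_le {f : ℝ → ℝ} {k : ℕ} {c : ℝ}
    (h : ∀ i ≤ k, ∀ x ∈ Icc (0:ℝ) 1, |iteratedDeriv i f x| ≤ c) :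
    sobSq k f ≤ (k + 1) * c ^ 2 := by
  refine (Finset.sum_le_card_nsmul _ _ (c ^ 2) fun i hi => L2sq_le_of_abs_le
    (h i (Finset.mem_range_succ_iff.mp hi))).trans ?_
  simp

/-- The one-dimensional Sobolev embedding `H¹(0,1) ⊂ L^∞(0,1)`. -/
theorem sq_le_L2sq_add_L2sq_deriv {g : ℝ → ℝ} (hg : ContDiff ℝ 1 g) {x : ℝ}
    (hx : x ∈ Icc (0:ℝ) 1) : g x ^ 2 ≤ 2 * L2sq g + L2sq (deriv g) := by
  have hc : Continuous g := hg.continuous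
  have hc' : Continuous (deriv g) := hg.continuous_deriv le_rfl
  have hci : Continuous fun t => g t ^ 2 := hc.pow 2
  have hgi : ∀ a b : ℝ, IntervalIntegrable (fun t => g t ^ 2 + deriv g t ^ 2) volume a b :=
    fun a b => ((hc.pow 2).add (hc'.pow 2)).intervalIntegrable a b
  have key : ∀ y ∈ Icc (0:ℝ) 1, g x ^ 2 ≤ g y ^ 2 + (L2sq g + L2sq (deriv g)) := by
    intro y hy
    have hF : ∫ t in y..x, 2 * g t * deriv g t = g x ^ 2 - g y ^ 2 := by
      refine intervalIntegral.integral_eq_sub_of_hasDerivAt (f := fun t => g t ^ 2) (fun t _ => ?_)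
        (((continuous_const.mul hc).mul hc').intervalIntegrable y x)
      have h := (hg.differentiable one_ne_zero t).hasDerivAt.fun_pow 2
      simpa only [Nat.cast_ofNat, Nat.add_one_sub_one, pow_one] using h
    have hle : |∫ t in y..x, 2 * g t * deriv g t| ≤ |∫ t in y..x, (g t ^ 2 + deriv g t ^ 2)| := by
      rw [← Real.norm_eq_abs]
      refine intervalIntegral.norm_integral_le_abs_of_norm_le
        (Filter.Eventually.of_forall fun t => ?_) (hgi y x)
      rw [Real.norm_eq_abs, abs_le]
      constructor <;> nlinarith [sq_nonneg (g t - deriv g t), sq_nonneg (g t + deriv g t)]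
    have hsub : |∫ t in y..x, (g t ^ 2 + deriv g t ^ 2)|
        ≤ |∫ t in (0:ℝ)..1, (g t ^ 2 + deriv g t ^ 2)| := by
      refine intervalIntegral.abs_integral_mono_interval ?_ ?_ (hgi 0 1)
      · rw [uIoc_of_le zero_le_one]
        exact Ioc_subset_Ioc (le_min hy.1 hx.1) (max_le hy.2 hx.2)
      · exact Filter.Eventually.of_forall fun t => by positivity
    have hsum : ∫ t in (0:ℝ)..1, (g t ^ 2 + deriv g t ^ 2) = L2sq g + L2sq (deriv g) :=
      intervalIntegral.integral_add ((hc.pow 2).intervalIntegrable 0 1)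
        ((hc'.pow 2).intervalIntegrable 0 1)
    rw [hsum, abs_of_nonneg (add_nonneg (L2sq_nonneg _) (L2sq_nonneg _))] at hsub
    have := (le_abs_self _).trans (hle.trans hsub)
    rw [hF] at this
    linarith
  have hca : Continuous fun t => g t ^ 2 + (L2sq g + L2sq (deriv g)) := by fun_prop
  have hmono := intervalIntegral.integral_mono_on (μ := volume) zero_le_one
    (intervalIntegrable_const (c := g x ^ 2))
    (hca.intervalIntegrable 0 1) key
  rw [intervalIntegral.integral_add (hci.intervalIntegrable 0 1)
    intervalIntegrable_const] at hmono
  simp only [intervalIntegral.integral_const, sub_zero, smul_eq_mul, one_mul] at hmono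
  change _ ≤ L2sq g + _ at hmono
  linarith

theorem abs_iteratedDeriv_le_delta0 {ρ : ℝ → ℝ} (hρ : ContDiff ℝ 4 ρ) {k : ℕ} (hk : k ≤ 2) {x : ℝ}
    (hx : x ∈ Icc (0:ℝ) 1) : |iteratedDeriv (k + 1) ρ x| ≤ 2 * delta0 ρ := by
  have hs : sobSq 3 (deriv ρ) = ∑ i ∈ Finset.range 4, L2sq (iteratedDeriv i (deriv ρ)) := rfl
  have hpos : ∀ i, 0 ≤ L2sq (iteratedDeriv i (deriv ρ)) := fun _ => L2sq_nonneg _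
  have hd : delta0 ρ ^ 2 = sobSq 3 (deriv ρ) :=
    Real.sq_sqrt (Finset.sum_nonneg fun i _ => hpos i)
  have hcd : ContDiff ℝ 1 (iteratedDeriv k (deriv ρ)) := by
    rw [iteratedDeriv_eq_iterate]
    refine ContDiff.iterate_deriv' 1 k ?_
    refine (contDiff_succ_iff_deriv (n := 3).mp hρ).2.2.of_le ?_
    interval_cases k <;> norm_num
  have h := sq_le_L2sq_add_L2sq_deriv hcd hx
  rw [← iteratedDeriv_succ] at h
  have hle : iteratedDeriv (k + 1) ρ x ^ 2 ≤ (2 * delta0 ρ) ^ 2 := by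
    rw [iteratedDeriv_succ', mul_pow, hd, hs]
    simp only [Finset.sum_range_succ, Finset.sum_range_zero]
    have := hpos 0; have := hpos 1; have := hpos 2; have := hpos 3
    interval_cases k <;> simp only [zero_add, Nat.reduceAdd] at h ⊢ <;> linarith
  exact abs_le_of_sq_le_sq hle (mul_nonneg zero_le_two (Real.sqrt_nonneg _))

/-- A `C¹` function of small arguments `s` and bounded arguments `b` that vanishes at `s = 0` is
bounded linearly in the size of `s`. -/
theorem exists_linear_bound {n m : ℕ} (F : (Fin n → ℝ) → (Fin m → ℝ) → ℝ)
    (hF : ContDiff ℝ 1 fun w : (Fin n → ℝ) × (Fin m → ℝ) => F w.1 w.2) (h0 : ∀ b, F 0 b = 0)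
    (B : ℝ) : ∃ K > (0:ℝ), ∀ (e : ℝ) (s : Fin n → ℝ) (b : Fin m → ℝ), 0 ≤ e → e ≤ B →
      (∀ i, |s i| ≤ e) → (∀ i, |b i| ≤ B) → |F s b| ≤ K * e := by
  obtain ⟨K, hK⟩ := LocallyLipschitzOn.exists_lipschitzOnWith_of_compact
    (isCompact_closedBall (0 : (Fin n → ℝ) × (Fin m → ℝ)) B)
    (hF.locallyLipschitz.locallyLipschitzOn)
  refine ⟨K + 1, by positivity, fun e s b he heB hs hb => ?_⟩
  have hB : 0 ≤ B := he.trans heB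
  have hsn : ‖s‖ ≤ e := (pi_norm_le_iff_of_nonneg he).mpr hs
  have hbn : ‖b‖ ≤ B := (pi_norm_le_iff_of_nonneg hB).mpr hb
  have h1 : (s, b) ∈ Metric.closedBall (0 : (Fin n → ℝ) × (Fin m → ℝ)) B := by
    rw [mem_closedBall_zero_iff, Prod.norm_def]
    exact max_le (hsn.trans heB) hbn
  have h2 : (0, b) ∈ Metric.closedBall (0 : (Fin n → ℝ) × (Fin m → ℝ)) B := by
    rw [mem_closedBall_zero_iff, Prod.norm_def]
    exact max_le (by simpa using hB) hbn
  have h := hK.dist_le_mul _ h1 _ h2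
  simp only [h0, Real.dist_eq, sub_zero] at h
  have hd : dist (s, b) ((0 : Fin n → ℝ), b) = ‖s‖ := by
    rw [Prod.dist_eq]; simp
  rw [hd] at h
  nlinarith [mul_le_mul_of_nonneg_left hsn K.coe_nonneg]

theorem momentum_equation {ν ε τ lam μ Jb Vb : ℝ} (hν : 0 < ν) {ρ p q r V : ℝ → ℝ}
    (hρ : ContDiff ℝ 4 ρ) (h : IsSteadyPerturbSol ν ε τ lam μ Jb Vb ρ p q r V) {x : ℝ}
    (hx : x ∈ Icc (0:ℝ) 1) (hρx : 0 < ρ x) {q2 : ℝ} (hq : q x = ν * deriv p x)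
    (hq1 : deriv q x = ν * iteratedDeriv 2 p x) (hq2 : iteratedDeriv 2 q x = ν * q2) :
    -(ν + ε ^ 2 / (18 * ν)) * (ν * q2) + ν * deriv p x / τ + μ * deriv p x
        + 2 / 3 * deriv r x - ρ x * deriv V x + Jb / τ + (1 + μ) * deriv ρ x
      = p x * deriv V x
        - 2 / 3 * (2 * (ν * deriv p x + Jb) * (ν * iteratedDeriv 2 p x) * (p x + ρ x)⁻¹
          - (ν * deriv p x + Jb) ^ 2 * (deriv p x + deriv ρ x) * ((p x + ρ x)⁻¹) ^ 2)
        + ε ^ 2 / 18 * (deriv p x + deriv ρ x) ^ 3 * ((p x + ρ x)⁻¹) ^ 2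
        + ε ^ 2 / 9 * (deriv p x + deriv ρ x) * (p x + ρ x)⁻¹ * iteratedDeriv 2 p x := by
  have e := h.eq2 x hx
  have hD : p x + ρ x ≠ 0 := (h.pos x hx).ne'
  have dp := (h.reg_p.differentiable (by norm_num) x).hasDerivAt
  have dq := (h.reg_q.differentiable (by norm_num) x).hasDerivAt
  have dρ := (hρ.differentiable (by norm_num) x).hasDerivAt
  have d1 : deriv (fun y => (q y + Jb) ^ 2 / (p y + ρ y)) x = _ :=
    (((dq.add_const Jb).fun_pow 2).fun_div (dp.fun_add dρ) hD).deriv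
  have d2 : deriv (fun y => p y + ρ y) x = _ := (dp.fun_add dρ).deriv
  simp only [f2fun, d1, d2, hq1, hq2, hq, coefA2, coefB2, coefC2, coefD2, coefE2] at e
  have hρ' := hρx.ne'
  rw [← sub_eq_zero] at e ⊢
  rw [← e]
  generalize hD' : p x + ρ x = D at *
  generalize deriv p x = p1
  generalize iteratedDeriv 2 p x = p2
  field_simp
  ring

/-- The energy equation solved for `ν r_xx`, as a function of the jets of the unknowns, with
`ι = 1 / (p + ρ)` and `ς = 1 / ρ`. -/
def energyRHS (ν ε τ μ J ρ1 ρ2 ρ3 p0 p1 p2 p3 r0 r1 v ρ0 ι ς : ℝ) : ℝ :=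
  (2 / τ - 5 / 3 * J * ρ1 * ς ^ 2) * r0
    + (-(3 / τ) + 5 / 2 * J * ρ1 ^ 2 * ς ^ 2 - 2 * J ^ 3 * ρ1 * ς ^ 4
        + ε ^ 2 / 3 * J * ρ1 ^ 4 * ς ^ 4) * p0
    + (-(5 / 2 * J * ς) - ε ^ 2 / 3 * J * ρ1 ^ 2 * ς ^ 3) * p1
    + (μ + 5 / 2 - J ^ 2 * ς ^ 2 + ε ^ 2 / (6 * ν) * J * ρ1 * ς ^ 2
        + ε ^ 2 / 18 * ρ1 ^ 2 * ς ^ 2) * (ν * p2)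
    + (2 * J ^ 2 * ς ^ 3 - ε ^ 2 / 9 * ρ1 ^ 3 * ς ^ 3) * (ν * p1)
    + 5 / 3 * J * ς * r1 - J * v
    - (-(2 / 3) * J ^ 3 * ς ^ 3 + ε ^ 2 / 9 * J * ρ1 * ς ^ 3)
    - ν * p1 * v
    + 5 / 3 * ((ν * p2 * ι - (ν * p1 + J) * (p1 + ρ1) * ι ^ 2) * (r0 + 3 / 2 * ρ0)
        + (ν * p1 + J) * ι * (r1 + 3 / 2 * ρ1))
    - 1 / 3 * (3 * (ν * p1 + J) ^ 2 * (ν * p2) * ι ^ 2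
        - 2 * (ν * p1 + J) ^ 3 * (p1 + ρ1) * ι ^ 3)
    - ε ^ 2 / 18 * (ν * p2 * (p2 + ρ2) * ι + (ν * p1 + J) * (p3 + ρ3) * ι
        - 3 * (ν * p1 + J) * (p2 + ρ2) * (p1 + ρ1) * ι ^ 2
        - ν * p2 * (p1 + ρ1) ^ 2 * ι ^ 2 + 2 * (ν * p1 + J) * (p1 + ρ1) ^ 3 * ι ^ 3)
    - 5 / 3 * (3 / 2 * J * ρ1 * ς + 3 / 2 * (ν * p2) + J * ς * r1 + 3 / 2 * ρ1 * ς * (ν * p1)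
        - 3 / 2 * J * ρ1 ^ 2 * ς ^ 2 * p0)
    + 5 / 3 * (3 / 2 * J * ρ1 * ς - 3 * J * ρ1 ^ 2 * ς ^ 2 * p0 + J * ρ1 * ς ^ 2 * r0
        + 3 / 2 * ρ1 * ς * (ν * p1) + 3 / 2 * J * ς * p1)
    + J ^ 2 * ς ^ 2 * (ν * p2)
    - 2 / 3 * (J ^ 3 * ς ^ 3 - 3 * J ^ 3 * ρ1 * ς ^ 4 * p0 + 3 * J ^ 2 * ς ^ 3 * (ν * p1))
    - ε ^ 2 / (6 * ν) * (J * ρ1 * ς ^ 2) * (ν * p2)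
    - ε ^ 2 / 18 * (ρ1 ^ 2 * ς ^ 2) * (ν * p2)
    + ε ^ 2 / 9 * (J * ρ1 ^ 3 * ς ^ 3 - 3 * J * ρ1 ^ 4 * ς ^ 4 * p0
        + 3 * J * ρ1 ^ 2 * ς ^ 3 * p1 + ρ1 ^ 3 * ς ^ 3 * (ν * p1))

theorem energy_equation {ν ε τ lam μ Jb Vb : ℝ} {ρ p q r V : ℝ → ℝ}
    (hρ : ContDiff ℝ 4 ρ) (h : IsSteadyPerturbSol ν ε τ lam μ Jb Vb ρ p q r V) {x : ℝ}
    (hx : x ∈ Icc (0:ℝ) 1) (hq : q x = ν * deriv p x)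
    (hq1 : deriv q x = ν * iteratedDeriv 2 p x) :
    ν * iteratedDeriv 2 r x = energyRHS ν ε τ μ Jb (deriv ρ x) (iteratedDeriv 2 ρ x)
      (iteratedDeriv 3 ρ x) (p x) (deriv p x) (iteratedDeriv 2 p x) (iteratedDeriv 3 p x)
      (r x) (deriv r x) (deriv V x) (ρ x) (p x + ρ x)⁻¹ (ρ x)⁻¹ := by
  have e := h.eq3 x hx
  have hD : p x + ρ x ≠ 0 := (h.pos x hx).ne'
  have dp := (h.reg_p.differentiable (by norm_num) x).hasDerivAt
  have dq := (h.reg_q.differentiable (by norm_num) x).hasDerivAt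
  have dr := (h.reg_r.differentiable (by norm_num) x).hasDerivAt
  have dρ := (hρ.differentiable (by norm_num) x).hasDerivAt
  have dp1 := hasDerivAt_deriv h.reg_p (by norm_num) x
  have dρ1 := hasDerivAt_deriv hρ (by norm_num) x
  have dp2 : HasDerivAt (iteratedDeriv 2 p) (iteratedDeriv 3 p x) x :=
    hasDerivAt_iteratedDeriv h.reg_p (by norm_num) x
  have dρ2 : HasDerivAt (iteratedDeriv 2 ρ) (iteratedDeriv 3 ρ x) x :=
    hasDerivAt_iteratedDeriv hρ (by norm_num) x
  have s1 : deriv (fun z => p z + ρ z) = fun z => deriv p z + deriv ρ z :=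
    funext fun z => deriv_fun_add (h.reg_p.differentiable (by norm_num) z)
      (hρ.differentiable (by norm_num) z)
  have s2 : iteratedDeriv 2 (fun z => p z + ρ z)
      = fun z => iteratedDeriv 2 p z + iteratedDeriv 2 ρ z := by
    rw [iteratedDeriv_succ, iteratedDeriv_one, s1]
    exact funext fun z => ((hasDerivAt_deriv h.reg_p (by norm_num) z).fun_add
      (hasDerivAt_deriv hρ (by norm_num) z)).deriv
  have d1 : deriv (fun y => (q y + Jb) / (p y + ρ y) * (r y + 3 / 2 * ρ y)) x
      = (deriv q x * (p x + ρ x)⁻¹ - (q x + Jb) * (deriv p x + deriv ρ x) * ((p x + ρ x)⁻¹) ^ 2)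
          * (r x + 3 / 2 * ρ x)
        + (q x + Jb) * (p x + ρ x)⁻¹ * (deriv r x + 3 / 2 * deriv ρ x) := by
    refine ((((dq.add_const Jb).fun_div (dp.fun_add dρ) hD).fun_mul
      (dr.fun_add (dρ.const_mul _))).deriv).trans ?_
    field_simp
  have d2 : deriv (fun y => (q y + Jb) ^ 3 / (p y + ρ y) ^ 2) x
      = 3 * (q x + Jb) ^ 2 * deriv q x * ((p x + ρ x)⁻¹) ^ 2
        - 2 * (q x + Jb) ^ 3 * (deriv p x + deriv ρ x) * ((p x + ρ x)⁻¹) ^ 3 := by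
    refine ((((dq.add_const Jb).fun_pow 3).fun_div ((dp.fun_add dρ).fun_pow 2)
      (pow_ne_zero 2 hD)).deriv).trans ?_
    simp only [Nat.cast_ofNat, Nat.add_one_sub_one, pow_one]
    field_simp
  have d3 : deriv (fun y => (q y + Jb) * (iteratedDeriv 2 p y + iteratedDeriv 2 ρ y) / (p y + ρ y)
      - (q y + Jb) * (deriv p y + deriv ρ y) ^ 2 / (p y + ρ y) ^ 2) x
      = deriv q x * (iteratedDeriv 2 p x + iteratedDeriv 2 ρ x) * (p x + ρ x)⁻¹
        + (q x + Jb) * (iteratedDeriv 3 p x + iteratedDeriv 3 ρ x) * (p x + ρ x)⁻¹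
        - 3 * (q x + Jb) * (iteratedDeriv 2 p x + iteratedDeriv 2 ρ x) * (deriv p x + deriv ρ x)
          * ((p x + ρ x)⁻¹) ^ 2
        - deriv q x * (deriv p x + deriv ρ x) ^ 2 * ((p x + ρ x)⁻¹) ^ 2
        + 2 * (q x + Jb) * (deriv p x + deriv ρ x) ^ 3 * ((p x + ρ x)⁻¹) ^ 3 := by
    refine (((((dq.add_const Jb).fun_mul (dp2.fun_add dρ2)).fun_div (dp.fun_add dρ) hD).fun_sub
      (((dq.add_const Jb).fun_mul ((dp1.fun_add dρ1).fun_pow 2)).fun_div ((dp.fun_add dρ).fun_pow 2)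
        (pow_ne_zero 2 hD))).deriv).trans ?_
    simp only [Nat.cast_ofNat, Nat.add_one_sub_one, pow_one]
    generalize p x + ρ x = D at *
    field_simp
    ring
  simp only [f3fun, s1, s2, d1, d2, d3, hq1, hq, coefA3, coefB3, coefC3, coefD3, coefE3,
    coefH3] at e
  unfold energyRHS
  linear_combination -e

theorem IsSteadyPerturbSol.flux_eq {ν ε τ lam μ Jb Vb : ℝ} {ρ p q r V : ℝ → ℝ}
    (h : IsSteadyPerturbSol ν ε τ lam μ Jb Vb ρ p q r V) {x : ℝ} (hx : x ∈ Icc (0:ℝ) 1) :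
    q x = ν * deriv p x ∧ deriv q x = ν * iteratedDeriv 2 p x ∧
      iteratedDeriv 2 q x = ν * iteratedDeriv 3 p x := by
  have h1 : EqOn (deriv q) (fun y => ν * iteratedDeriv 2 p y) (Icc 0 1) := fun y hy => by
    have := h.eq1 y hy
    dsimp only
    linarith
  have hd : ∀ y, HasDerivAt (fun y => q y - ν * deriv p y)
      (deriv q y - ν * iteratedDeriv 2 p y) y := fun y =>
    ((h.reg_q.differentiable (by norm_num) y).hasDerivAt).fun_sub
      ((hasDerivAt_deriv h.reg_p (by norm_num) y).const_mul ν)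
  have hd3 : ∀ y, HasDerivAt (fun y => ν * iteratedDeriv 2 p y) (ν * iteratedDeriv 3 p y) y :=
    fun y => (hasDerivAt_iteratedDeriv h.reg_p (by norm_num) y).const_mul ν
  have hp0 := (h.bc_p 1 (by norm_num)).1
  rw [iteratedDeriv_one] at hp0
  refine ⟨?_, h1 hx, ?_⟩
  · have hc := constant_of_derivWithin_zero (f := fun y => q y - ν * deriv p y) (a := 0) (b := 1)
      (fun y _ => (hd y).differentiableAt.differentiableWithinAt) (fun y hy => by
        have hy' : y ∈ Icc (0:ℝ) 1 := ⟨hy.1, hy.2.le⟩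
        rw [(hd y).hasDerivWithinAt.derivWithin (uniqueDiffOn_Icc zero_lt_one y hy'), h1 hy',
          sub_self]) x hx
    simp only [h.bc_q.1, hp0, mul_zero, sub_zero] at hc
    linarith
  · have hq : Differentiable ℝ (deriv q) := fun y =>
      (hasDerivAt_deriv h.reg_q (by norm_num) y).differentiableAt
    have := deriv_eqOn_Icc hq (fun y => (hd3 y).differentiableAt) h1 hx
    rwa [(hd3 x).deriv, (hasDerivAt_deriv h.reg_q (by norm_num) x).deriv] at this

/-- At `x`, the current, the doping variation, the jet of `p` and the electric field are at most
`e` in size. -/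
structure SmallJet (ρb Jb e : ℝ) (ρ p V : ℝ → ℝ) (x : ℝ) : Prop where
  J : |Jb| ≤ e
  ρ0 : |ρ x - ρb| ≤ e
  ρ1 : |deriv ρ x| ≤ e
  ρ2 : |iteratedDeriv 2 ρ x| ≤ e
  ρ3 : |iteratedDeriv 3 ρ x| ≤ e
  p0 : |p x| ≤ e
  p1 : |deriv p x| ≤ e
  p2 : |iteratedDeriv 2 p x| ≤ e
  v : |deriv V x| ≤ e

theorem SmallJet.nonneg {ρb Jb e : ℝ} {ρ p V : ℝ → ℝ} {x : ℝ} (h : SmallJet ρb Jb e ρ p V x) :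
    0 ≤ e := (abs_nonneg _).trans h.J

theorem SmallJet.density {ρb Jb e : ℝ} (hρb : 0 < ρb) {ρ p V : ℝ → ℝ} {x : ℝ}
    (h : SmallJet ρb Jb e ρ p V x) (he : e ≤ ρb / 4) :
    0 < ρ x ∧ |ρ x| ≤ 2 * ρb ∧ |(ρ x)⁻¹| ≤ 2 / ρb ∧ |(p x + ρ x)⁻¹| ≤ 2 / ρb := by
  have h0 := abs_le.mp h.ρ0
  have h1 := abs_le.mp h.p0
  have hρ : ρb / 2 ≤ ρ x := by linarith
  have hD : ρb / 2 ≤ p x + ρ x := by linarith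
  have hinv : ∀ y, ρb / 2 ≤ y → |y⁻¹| ≤ 2 / ρb := fun y hy => by
    rw [abs_of_nonneg (inv_nonneg.mpr (by linarith)), ← inv_div]
    exact inv_anti₀ (by linarith) hy
  exact ⟨by linarith, abs_le.mpr ⟨by linarith, by linarith⟩, hinv _ hρ, hinv _ hD⟩

theorem exists_momentum_bound (ν ε τ lam μ : ℝ) {ρb : ℝ} (hν : 0 < ν) (hρb : 0 < ρb) :
    ∃ K > (0:ℝ), ∀ (Vb Jb e : ℝ) (ρ p q r V : ℝ → ℝ) (x : ℝ), ContDiff ℝ 4 ρ →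
      IsSteadyPerturbSol ν ε τ lam μ Jb Vb ρ p q r V → x ∈ Icc (0:ℝ) 1 → e ≤ 1 → e ≤ ρb / 4 →
      SmallJet ρb Jb e ρ p V x →
      |-(ν + ε ^ 2 / (18 * ν)) * (ν * iteratedDeriv 3 p x) + ν * deriv p x / τ + μ * deriv p x
        + 2 / 3 * deriv r x - ρb * deriv V x + Jb / τ + (1 + μ) * deriv ρ x| ≤ K * e ^ 2 := by
  obtain ⟨K₁, hK₁, H₁⟩ := exists_linear_bound
    (fun (s : Fin 4 → ℝ) (b : Fin 1 → ℝ) => -(2 / 3) * (2 * ν * s 0 * b 0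
      - (ν * s 1 + s 2) * (s 1 + s 3) * b 0 ^ 2)) (by fun_prop) (by simp) (1 + 2 / ρb)
  obtain ⟨K₂, hK₂, H₂⟩ := exists_linear_bound
    (fun (s : Fin 4 → ℝ) (b : Fin 1 → ℝ) => ε ^ 2 / 18 * (s 1 + s 3) ^ 2 * b 0 ^ 2
      + ε ^ 2 / 9 * b 0 * s 0) (by fun_prop) (by simp) (1 + 2 / ρb)
  refine ⟨2 + (ν + 1) * K₁ + 2 * K₂, by positivity,
    fun Vb Jb e ρ p q r V x hρ h hx he1 he4 hs => ?_⟩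
  have he := hs.nonneg
  obtain ⟨hρx, -, -, hι⟩ := hs.density hρb he4
  obtain ⟨hq, hq1, hq2⟩ := h.flux_eq hx
  have eq := momentum_equation hν hρ h hx hρx hq hq1 hq2
  have hB2 : 0 < 2 / ρb := by positivity
  have hB : e ≤ 1 + 2 / ρb := by linarith
  have g₁ := H₁ e ![iteratedDeriv 2 p x, deriv p x, Jb, deriv ρ x] ![(p x + ρ x)⁻¹] he hB
    (by simp [Fin.forall_fin_succ, hs.p2, hs.p1, hs.J, hs.ρ1])
    (Fin.forall_fin_one.mpr (hι.trans (by linarith)))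
  have g₂ := H₂ e ![iteratedDeriv 2 p x, deriv p x, Jb, deriv ρ x] ![(p x + ρ x)⁻¹] he hB
    (by simp [Fin.forall_fin_succ, hs.p2, hs.p1, hs.J, hs.ρ1])
    (Fin.forall_fin_one.mpr (hι.trans (by linarith)))
  simp only [Matrix.cons_val] at g₁ g₂
  set G₁ := -(2 / 3) * (2 * ν * iteratedDeriv 2 p x * (p x + ρ x)⁻¹
      - (ν * deriv p x + Jb) * (deriv p x + deriv ρ x) * (p x + ρ x)⁻¹ ^ 2) with hG₁
  set G₂ := ε ^ 2 / 18 * (deriv p x + deriv ρ x) ^ 2 * (p x + ρ x)⁻¹ ^ 2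
      + ε ^ 2 / 9 * (p x + ρ x)⁻¹ * iteratedDeriv 2 p x with hG₂
  have hsplit : -(ν + ε ^ 2 / (18 * ν)) * (ν * iteratedDeriv 3 p x) + ν * deriv p x / τ
      + μ * deriv p x + 2 / 3 * deriv r x - ρb * deriv V x + Jb / τ + (1 + μ) * deriv ρ x
      = (ρ x - ρb + p x) * deriv V x + (ν * deriv p x + Jb) * G₁
        + (deriv p x + deriv ρ x) * G₂ := by
    rw [hG₁, hG₂]
    linear_combination eq
  have b1 : |ρ x - ρb + p x| ≤ 2 * e := (abs_add_le _ _).trans (by linarith [hs.ρ0, hs.p0])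
  have b2 : |ν * deriv p x + Jb| ≤ (ν + 1) * e := (abs_add_le _ _).trans (by
    rw [abs_mul, abs_of_pos hν]
    nlinarith [hs.p1, hs.J])
  have b3 : |deriv p x + deriv ρ x| ≤ 2 * e := (abs_add_le _ _).trans (by linarith [hs.ρ1, hs.p1])
  have m1 := mul_le_mul b1 hs.v (abs_nonneg _) (by positivity)
  have m2 := mul_le_mul b2 g₁ (abs_nonneg _) (by positivity)
  have m3 := mul_le_mul b3 g₂ (abs_nonneg _) (by positivity)
  rw [← abs_mul] at m1 m2 m3
  rw [hsplit]
  refine (abs_add_three _ _ _).trans ((add_le_add_three m1 m2 m3).trans_eq ?_)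
  ring

theorem exists_jet_bound (ν ε τ lam μ : ℝ) {ρb : ℝ} (hν : 0 < ν) (hτ : 0 < τ) (hμ : 0 < μ)
    (hρb : 0 < ρb) :
    ∃ K > (0:ℝ), ∀ (Vb Jb e : ℝ) (ρ p q r V : ℝ → ℝ) (x : ℝ), ContDiff ℝ 4 ρ →
      IsSteadyPerturbSol ν ε τ lam μ Jb Vb ρ p q r V → x ∈ Icc (0:ℝ) 1 → e ≤ 1 → e ≤ ρb / 4 →
      SmallJet ρb Jb e ρ p V x → |r x| ≤ e → |deriv r x| ≤ e →
      |iteratedDeriv 3 p x| ≤ K * e ∧ |iteratedDeriv 2 r x| ≤ K * e := by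
  obtain ⟨K₁, hK₁, H₁⟩ := exists_momentum_bound ν ε τ lam μ hν hρb
  set a := (ν + ε ^ 2 / (18 * ν)) * ν with ha
  have ha0 : 0 < a := by positivity
  set C := (ν / τ + μ + 2 / 3 + ρb + 1 / τ + (1 + μ) + K₁) / a + 1 with hC
  have hC1 : 1 ≤ C := by rw [hC, le_add_iff_nonneg_left]; positivity
  have hB2 : 0 < 2 / ρb := by positivity
  obtain ⟨K₂, hK₂, H₂⟩ := exists_linear_bound
    (fun (s : Fin 11 → ℝ) (b : Fin 3 → ℝ) => energyRHS ν ε τ μ (s 0) (s 1) (s 2) (s 3) (s 4)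
      (s 5) (s 6) (s 7) (s 8) (s 9) (s 10) (b 0) (b 1) (b 2)) (by unfold energyRHS; fun_prop)
    (by simp [energyRHS]) (C + 2 * ρb + 2 / ρb)
  refine ⟨C + K₂ * C / ν, by positivity,
    fun Vb Jb e ρ p q r V x hρ h hx he1 he4 hs hr hr1 => ?_⟩
  have he := hs.nonneg
  have hp3 : |iteratedDeriv 3 p x| ≤ C * e := by
    have H := abs_le.mp (H₁ Vb Jb e ρ p q r V x hρ h hx he1 he4 hs)
    have t1 : |ν * deriv p x / τ| ≤ ν / τ * e := by
      rw [mul_div_right_comm, abs_mul, abs_of_pos (by positivity : 0 < ν / τ)]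
      exact mul_le_mul_of_nonneg_left hs.p1 (by positivity)
    have t2 : |μ * deriv p x| ≤ μ * e := by
      rw [abs_mul, abs_of_pos hμ]
      exact mul_le_mul_of_nonneg_left hs.p1 hμ.le
    have t3 : |ρb * deriv V x| ≤ ρb * e := by
      rw [abs_mul, abs_of_pos hρb]
      exact mul_le_mul_of_nonneg_left hs.v hρb.le
    have t4 : |Jb / τ| ≤ 1 / τ * e := by
      rw [div_eq_inv_mul, abs_mul, abs_of_pos (inv_pos.mpr hτ), one_div]
      exact mul_le_mul_of_nonneg_left hs.J (by positivity)
    have t5 : |(1 + μ) * deriv ρ x| ≤ (1 + μ) * e := by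
      rw [abs_mul, abs_of_pos (by positivity : 0 < 1 + μ)]
      exact mul_le_mul_of_nonneg_left hs.ρ1 (by positivity)
    have t6 : K₁ * e ^ 2 ≤ K₁ * e := mul_le_mul_of_nonneg_left (by nlinarith) hK₁.le
    have t := abs_le.mp hr1
    have t1 := abs_le.mp t1
    have t2 := abs_le.mp t2
    have t3 := abs_le.mp t3
    have t4 := abs_le.mp t4
    have t5 := abs_le.mp t5
    have hA : |a * iteratedDeriv 3 p x|
        ≤ (ν / τ + μ + 2 / 3 + ρb + 1 / τ + (1 + μ) + K₁) * e := by
      rw [abs_le]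
      constructor <;> rw [ha] <;> linarith
    rw [abs_mul, abs_of_pos ha0] at hA
    calc |iteratedDeriv 3 p x|
        ≤ (ν / τ + μ + 2 / 3 + ρb + 1 / τ + (1 + μ) + K₁) * e / a := by
          rw [le_div_iff₀ ha0]; linarith
      _ ≤ C * e := by
          rw [mul_div_right_comm]
          exact mul_le_mul_of_nonneg_right (by rw [hC]; linarith) he
  have heC : e ≤ C * e := le_mul_of_one_le_left he hC1
  obtain ⟨-, hρ0, hς, hι⟩ := hs.density hρb he4
  obtain ⟨hq, hq1, -⟩ := h.flux_eq hx
  have hE := H₂ (C * e) ![Jb, deriv ρ x, iteratedDeriv 2 ρ x, iteratedDeriv 3 ρ x, p x, deriv p x,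
      iteratedDeriv 2 p x, iteratedDeriv 3 p x, r x, deriv r x, deriv V x]
    ![ρ x, (p x + ρ x)⁻¹, (ρ x)⁻¹] (by positivity) (by nlinarith)
    (by simp [Fin.forall_fin_succ, hs.J.trans heC, hs.ρ1.trans heC, hs.ρ2.trans heC,
          hs.ρ3.trans heC, hs.p0.trans heC, hs.p1.trans heC, hs.p2.trans heC, hp3, hr.trans heC,
          hr1.trans heC, hs.v.trans heC])
    (by simp only [Fin.forall_fin_succ, Matrix.cons_val_zero, Matrix.cons_val_succ,
          IsEmpty.forall_iff, and_true]
        refine ⟨?_, ?_, ?_⟩ <;> linarith)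
  simp only [Matrix.cons_val] at hE
  rw [← energy_equation hρ h hx hq hq1, abs_mul, abs_of_pos hν] at hE
  refine ⟨hp3.trans (mul_le_mul_of_nonneg_right (le_add_of_nonneg_right (by positivity)) he), ?_⟩
  calc |iteratedDeriv 2 r x| ≤ K₂ * (C * e) / ν := by rw [le_div_iff₀ hν]; linarith
    _ = K₂ * C / ν * e := by ring
    _ ≤ _ := mul_le_mul_of_nonneg_right (le_add_of_nonneg_left (by positivity)) he

/-- On `[0,1]` the doping profile and its first three derivatives deviate from the constant `ρb`
by at most `M`. -/
def SmallDoping (ρb M : ℝ) (ρ : ℝ → ℝ) : Prop :=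
  ∀ x ∈ Icc (0:ℝ) 1, |ρ x - ρb| ≤ M ∧ |deriv ρ x| ≤ M ∧ |iteratedDeriv 2 ρ x| ≤ M ∧
    |iteratedDeriv 3 ρ x| ≤ M

/-- The squared size of the state `(p, p_x, p_xx, r, r_x, V_x)` at a point. -/
def stateSq (p r V : ℝ → ℝ) (x : ℝ) : ℝ :=
  p x ^ 2 + deriv p x ^ 2 + iteratedDeriv 2 p x ^ 2 + r x ^ 2 + deriv r x ^ 2 + deriv V x ^ 2

theorem smallJet_of_stateSq_le {ρb M e Jb : ℝ} {ρ p r V : ℝ → ℝ} {x : ℝ} (he : 0 ≤ e)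
    (hx : x ∈ Icc (0:ℝ) 1) (hρ : SmallDoping ρb M ρ) (hJ : |Jb| ≤ M) (hM : M ≤ e)
    (h : stateSq p r V x ≤ e ^ 2) : SmallJet ρb Jb e ρ p V x ∧ |r x| ≤ e ∧ |deriv r x| ≤ e := by
  obtain ⟨h0, h1, h2, h3⟩ := hρ x hx
  unfold stateSq at h
  have s1 := sq_nonneg (p x)
  have s2 := sq_nonneg (deriv p x)
  have s3 := sq_nonneg (iteratedDeriv 2 p x)
  have s4 := sq_nonneg (r x)
  have s5 := sq_nonneg (deriv r x)
  have s6 := sq_nonneg (deriv V x)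
  exact ⟨⟨hJ.trans hM, h0.trans hM, h1.trans hM, h2.trans hM, h3.trans hM,
    abs_le_of_sq_le_sq (by linarith) he, abs_le_of_sq_le_sq (by linarith) he,
    abs_le_of_sq_le_sq (by linarith) he, abs_le_of_sq_le_sq (by linarith) he⟩,
    abs_le_of_sq_le_sq (by linarith) he, abs_le_of_sq_le_sq (by linarith) he⟩

theorem IsSteadyPerturbSol.stateSq_zero {ν ε τ lam μ Jb Vb : ℝ} {ρ p q r V : ℝ → ℝ}
    (h : IsSteadyPerturbSol ν ε τ lam μ Jb Vb ρ p q r V) : p 0 = 0 ∧ deriv p 0 = 0 ∧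
      iteratedDeriv 2 p 0 = 0 ∧ iteratedDeriv 3 p 0 = 0 ∧ stateSq p r V 0 = deriv r 0 ^ 2 := by
  have h0 := (h.bc_p 0 (by norm_num)).1
  have h1 := (h.bc_p 1 (by norm_num)).1
  have h2 := (h.bc_p 2 (by norm_num)).1
  rw [iteratedDeriv_zero] at h0
  rw [iteratedDeriv_one] at h1
  refine ⟨h0, h1, h2, (h.bc_p 3 le_rfl).1, ?_⟩
  simp [stateSq, h0, h1, h2, h.bc_r.1, h.bc_V.1]

theorem IsSteadyPerturbSol.hasDerivAt_stateSq {ν ε τ lam μ Jb Vb : ℝ} (hlam : 0 < lam)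
    {ρ p q r V : ℝ → ℝ} (h : IsSteadyPerturbSol ν ε τ lam μ Jb Vb ρ p q r V) {x : ℝ}
    (hx : x ∈ Icc (0:ℝ) 1) :
    HasDerivAt (stateSq p r V) (2 * (p x * deriv p x + deriv p x * iteratedDeriv 2 p x
      + iteratedDeriv 2 p x * iteratedDeriv 3 p x + r x * deriv r x
      + deriv r x * iteratedDeriv 2 r x + deriv V x * (p x / lam ^ 2))) x := by
  have hV : iteratedDeriv 2 V x = p x / lam ^ 2 := by
    have := h.eq4 x hx
    rw [eq_div_iff (by positivity)]
    linarith
  have dp := (h.reg_p.differentiable (by norm_num) x).hasDerivAt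
  have dr := (h.reg_r.differentiable (by norm_num) x).hasDerivAt
  have dp2 : HasDerivAt (iteratedDeriv 2 p) (iteratedDeriv 3 p x) x :=
    hasDerivAt_iteratedDeriv h.reg_p (by norm_num) x
  have d := (((((dp.fun_pow 2).fun_add ((hasDerivAt_deriv h.reg_p (by norm_num) x).fun_pow 2)
    ).fun_add (dp2.fun_pow 2)).fun_add (dr.fun_pow 2)).fun_add
    ((hasDerivAt_deriv h.reg_r (by norm_num) x).fun_pow 2)).fun_add
    ((hasDerivAt_deriv h.reg_V (by norm_num) x).fun_pow 2)
  rw [hV] at d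
  refine d.congr_deriv ?_
  simp only [Nat.cast_ofNat, Nat.add_one_sub_one, pow_one]
  ring

theorem exists_initial_bound (ν ε lam : ℝ) {τ μ ρb : ℝ} (hν : 0 < ν) (hτ : 0 < τ) (hμ : 0 < μ)
    (hρb : 0 < ρb) :
    ∃ C > (0:ℝ), ∀ (Vb Jb M : ℝ) (ρ p q r V : ℝ → ℝ), ContDiff ℝ 4 ρ →
      IsSteadyPerturbSol ν ε τ lam μ Jb Vb ρ p q r V → M ≤ 1 → M ≤ ρb / 4 → |Jb| ≤ M →
      SmallDoping ρb M ρ → stateSq p r V 0 ≤ (C * M) ^ 2 := by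
  obtain ⟨K, hK, H⟩ := exists_momentum_bound ν ε τ lam μ hν hρb
  refine ⟨3 / 2 * (1 / τ + (1 + μ) + K), by positivity,
    fun Vb Jb M ρ p q r V hρ h hM1 hM4 hJ hd => ?_⟩
  have hM : 0 ≤ M := (abs_nonneg _).trans hJ
  have h0 : (0:ℝ) ∈ Icc (0:ℝ) 1 := left_mem_Icc.mpr zero_le_one
  obtain ⟨hp0, hp1, hp2, hp3, hS⟩ := h.stateSq_zero
  obtain ⟨g0, g1, g2, g3⟩ := hd 0 h0
  have hm := H Vb Jb M ρ p q r V 0 hρ h h0 hM1 hM4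
    ⟨hJ, g0, g1, g2, g3, by simpa [hp0], by simpa [hp1], by simpa [hp2], by simpa [h.bc_V.1]⟩
  simp only [hp3, hp1, h.bc_V.1, mul_zero, zero_div, zero_add, add_zero, sub_zero] at hm
  have t1 : |Jb / τ| ≤ 1 / τ * M := by
    rw [div_eq_inv_mul, abs_mul, abs_of_pos (inv_pos.mpr hτ), one_div]
    exact mul_le_mul_of_nonneg_left hJ (by positivity)
  have t2 : |(1 + μ) * deriv ρ 0| ≤ (1 + μ) * M := by
    rw [abs_mul, abs_of_pos (by positivity : 0 < 1 + μ)]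
    exact mul_le_mul_of_nonneg_left g1 (by positivity)
  have t3 : K * M ^ 2 ≤ K * M := mul_le_mul_of_nonneg_left (by nlinarith) hK.le
  have hm := abs_le.mp hm
  have t1 := abs_le.mp t1
  have t2 := abs_le.mp t2
  rw [hS, sq_le_sq, abs_of_nonneg (by positivity : 0 ≤ 3 / 2 * (1 / τ + (1 + μ) + K) * M), abs_le]
  constructor <;> linarith

theorem exists_stateSq_bound (ν ε : ℝ) {τ lam μ ρb : ℝ} (hν : 0 < ν) (hτ : 0 < τ)
    (hlam : 0 < lam) (hμ : 0 < μ) (hρb : 0 < ρb) :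
    ∃ C ≥ (1:ℝ), ∃ M₀ > (0:ℝ), ∀ (Vb Jb M : ℝ) (ρ p q r V : ℝ → ℝ), ContDiff ℝ 4 ρ →
      IsSteadyPerturbSol ν ε τ lam μ Jb Vb ρ p q r V → 0 < M → M ≤ M₀ → |Jb| ≤ M →
      SmallDoping ρb M ρ → ∀ x ∈ Icc (0:ℝ) 1, stateSq p r V x ≤ C * M ^ 2 := by
  obtain ⟨K, hK, HK⟩ := exists_jet_bound ν ε τ lam μ hν hτ hμ hρb
  obtain ⟨C₀, hC₀, H₀⟩ := exists_initial_bound ν ε lam hν hτ hμ hρb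
  set L := 2 * (3 + 2 * K + 1 / lam ^ 2) + 1 with hL
  have hL0 : 0 < L := by positivity
  set A := C₀ ^ 2 + 1 with hA
  set C := A * Real.exp L with hC
  have hA1 : 1 ≤ A := by rw [hA]; nlinarith
  have hC1 : 1 ≤ C := one_le_mul_of_one_le_of_one_le hA1 (Real.one_le_exp hL0.le)
  set κ := min 1 (ρb / 4) with hκ
  have hκ0 : 0 < κ := by rw [hκ]; positivity
  have hκ1 : κ ≤ 1 := min_le_left _ _
  have hκ4 : κ ≤ ρb / 4 := min_le_right _ _
  refine ⟨C, hC1, κ / C, by positivity, fun Vb Jb M ρ p q r V hρ h hM hM₀ hJ hd => ?_⟩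
  have hCM : C * M ≤ κ := by rwa [le_div_iff₀ (by positivity), mul_comm] at hM₀
  have hMκ : M ≤ κ := (le_mul_of_one_le_left hM.le hC1).trans hCM
  have hCκ : C * M ^ 2 ≤ κ ^ 2 := by
    calc C * M ^ 2 = C * M * M := by ring
      _ ≤ κ * κ := mul_le_mul hCM hMκ hM.le hκ0.le
      _ = κ ^ 2 := by ring
  have hle : ∀ x ∈ Icc (0:ℝ) 1, A * M ^ 2 * Real.exp (L * x) ≤ C * M ^ 2 := fun x hx => by
    have : Real.exp (L * x) ≤ Real.exp L := Real.exp_le_exp.mpr (by nlinarith [hx.2])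
    calc A * M ^ 2 * Real.exp (L * x) ≤ A * M ^ 2 * Real.exp L :=
          mul_le_mul_of_nonneg_left this (by positivity)
      _ = C * M ^ 2 := by rw [hC]; ring
  have hB : ∀ x, HasDerivAt (fun x => A * M ^ 2 * Real.exp (L * x))
      (L * (A * M ^ 2 * Real.exp (L * x))) x := fun x => by
    have d := (((hasDerivAt_id' x).const_mul L).exp).const_mul (A * M ^ 2)
    exact d.congr_deriv (by ring)
  have hS := fun x hx => h.hasDerivAt_stateSq hlam (x := x) hx
  have key := image_le_of_deriv_right_lt_deriv_boundary
    (f := fun x => stateSq p r V x + M ^ 2) (a := 0) (b := 1)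
    (fun x hx => ((hS x hx).continuousAt.add continuousAt_const).continuousWithinAt)
    (fun x hx => ((hS x ⟨hx.1, hx.2.le⟩).add_const (M ^ 2)).hasDerivWithinAt)
    (by
      have := H₀ Vb Jb M ρ p q r V hρ h (hMκ.trans hκ1) (hMκ.trans hκ4) hJ hd
      simp only [mul_zero, Real.exp_zero, mul_one]
      rw [hA]
      linarith)
    hB (fun x hx hx' => by
      have hxI : x ∈ Icc (0:ℝ) 1 := ⟨hx.1, hx.2.le⟩
      rw [← hx']
      have hS0 : 0 ≤ stateSq p r V x := by unfold stateSq; positivity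
      have hEκ : stateSq p r V x + M ^ 2 ≤ κ ^ 2 := hx'.le.trans ((hle x hxI).trans hCκ)
      set E := stateSq p r V x + M ^ 2 with hE
      have hE0 : 0 < E := by positivity
      obtain ⟨hj, hr, hr1⟩ := smallJet_of_stateSq_le (Jb := Jb) (p := p) (r := r) (V := V)
        (Real.sqrt_nonneg E) hxI hd hJ (Real.le_sqrt_of_sq_le (by linarith))
        (by rw [Real.sq_sqrt hE0.le]; linarith [sq_nonneg M])
      have heκ : √E ≤ κ := Real.sqrt_le_iff.mpr ⟨hκ0.le, hEκ⟩
      obtain ⟨hp3, hr2⟩ := HK Vb Jb _ ρ p q r V x hρ h hxI (heκ.trans hκ1) (heκ.trans hκ4) hj hr hr1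
      have hee : √E * √E = E := Real.mul_self_sqrt hE0.le
      have he := Real.sqrt_nonneg E
      have hmul : ∀ {a b c d : ℝ}, |a| ≤ c → |b| ≤ d → a * b ≤ c * d := fun {a b c d} ha hb =>
        (le_abs_self _).trans ((abs_mul a b).trans_le
          (mul_le_mul ha hb (abs_nonneg _) ((abs_nonneg _).trans ha)))
      have hVp : |p x / lam ^ 2| ≤ 1 / lam ^ 2 * √E := by
        rw [abs_div, abs_of_pos (by positivity : 0 < lam ^ 2), one_div, ← div_eq_inv_mul]
        gcongr
        exact hj.p0
      have m1 := hmul hj.p0 hj.p1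
      have m2 := hmul hj.p1 hj.p2
      have m3 := hmul hj.p2 hp3
      have m4 := hmul hr hr1
      have m5 := hmul hr1 hr2
      have m6 := hmul hj.v hVp
      have hLE : L * E = 2 * (√E * √E + √E * √E + √E * (K * √E) + √E * √E + √E * (K * √E)
          + √E * (1 / lam ^ 2 * √E)) + E := by
        rw [hL]
        linear_combination (-2 * (3 + 2 * K + 1 / lam ^ 2)) * hee
      rw [hLE]
      linarith)
  intro x hx
  have := (key hx).trans (hle x hx)
  linarith [sq_nonneg M]

theorem exists_solution_bound (ν ε : ℝ) {τ lam μ ρb : ℝ} (hν : 0 < ν) (hτ : 0 < τ)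
    (hlam : 0 < lam) (hμ : 0 < μ) (hρb : 0 < ρb) :
    ∃ C > (0:ℝ), ∃ M₀ > (0:ℝ), ∀ (Vb Jb M : ℝ) (ρ p q r V : ℝ → ℝ), ContDiff ℝ 4 ρ →
      IsSteadyPerturbSol ν ε τ lam μ Jb Vb ρ p q r V → M ≤ M₀ → |Jb| ≤ M →
      SmallDoping ρb M ρ → C * M ≤ 1 ∧ C * M ≤ ρb / 4 ∧ ∀ x ∈ Icc (0:ℝ) 1,
        SmallJet ρb Jb (C * M) ρ p V x ∧ |r x| ≤ C * M ∧ |deriv r x| ≤ C * M ∧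
        |iteratedDeriv 3 p x| ≤ C * M ∧ |iteratedDeriv 2 r x| ≤ C * M := by
  obtain ⟨K, hK, HK⟩ := exists_jet_bound ν ε τ lam μ hν hτ hμ hρb
  obtain ⟨A, hA1, M₁, hM₁, H⟩ := exists_stateSq_bound ν ε hν hτ hlam hμ hρb
  set C := A + K * A with hC
  have hC0 : 0 < C := by positivity
  have hAC : A ≤ C := by rw [hC, le_add_iff_nonneg_right]; positivity
  refine ⟨C, hC0, min (M₁ / 2) (min 1 (ρb / 4) / C), by positivity,
    fun Vb Jb M ρ p q r V hρ h hM₀ hJ hd => ?_⟩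
  have hM : 0 ≤ M := (abs_nonneg _).trans hJ
  have hCM : C * M ≤ min 1 (ρb / 4) := by
    have := hM₀.trans (min_le_right _ _)
    rwa [le_div_iff₀ hC0, mul_comm] at this
  have hM₁' : M ≤ M₁ / 2 := hM₀.trans (min_le_left _ _)
  have hC1 := hCM.trans (min_le_left _ _)
  have hC4 := hCM.trans (min_le_right _ _)
  refine ⟨hC1, hC4, fun x hx => ?_⟩
  have hS : stateSq p r V x ≤ A * M ^ 2 := by
    have ht : Filter.Tendsto (fun s : ℝ => A * (M + s) ^ 2) (nhdsWithin 0 (Ioi 0))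
        (nhds (A * M ^ 2)) := by
      have : Continuous fun s : ℝ => A * (M + s) ^ 2 := by fun_prop
      simpa using (this.tendsto 0).mono_left nhdsWithin_le_nhds
    refine ge_of_tendsto ht ?_
    filter_upwards [Ioo_mem_nhdsGT (half_pos hM₁)] with s hs
    have hMs : M ≤ M + s := by linarith [hs.1]
    exact H Vb Jb (M + s) ρ p q r V hρ h (by linarith [hs.1]) (by linarith [hs.2]) (hJ.trans hMs)
      (fun y hy => by
        obtain ⟨h0, h1, h2, h3⟩ := hd y hy
        exact ⟨h0.trans hMs, h1.trans hMs, h2.trans hMs, h3.trans hMs⟩) x hx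
  have hAM : A * M ≤ C * M := mul_le_mul_of_nonneg_right hAC hM
  have hS' : ∀ B ≥ A, stateSq p r V x ≤ (B * M) ^ 2 := fun B hB => hS.trans (by
    rw [mul_pow]
    exact mul_le_mul_of_nonneg_right (by nlinarith) (sq_nonneg M))
  have hMB : ∀ B ≥ A, M ≤ B * M := fun B hB => le_mul_of_one_le_left hM (hA1.trans hB)
  obtain ⟨hj, hr, hr1⟩ := smallJet_of_stateSq_le (by positivity) hx hd hJ (hMB A le_rfl)
    (hS' A le_rfl)
  obtain ⟨hp3, hr2⟩ := HK Vb Jb _ ρ p q r V x hρ h hx (hAM.trans hC1) (hAM.trans hC4) hj hr hr1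
  have hKM : K * (A * M) ≤ C * M := by rw [hC]; nlinarith [mul_nonneg (zero_le_one.trans hA1) hM]
  obtain ⟨hj', -, -⟩ := smallJet_of_stateSq_le (by positivity) hx hd hJ (hMB C hAC) (hS' C hAC)
  exact ⟨hj', hr.trans hAM, hr1.trans hAM, hp3.trans hKM, hr2.trans hKM⟩

theorem abs_sub_zero_le_of_hasDerivAt {f f' : ℝ → ℝ} {c : ℝ} (hf : ∀ x, HasDerivAt f (f' x) x)
    (h : ∀ x ∈ Icc (0:ℝ) 1, |f' x| ≤ c) {x : ℝ} (hx : x ∈ Icc (0:ℝ) 1) : |f x - f 0| ≤ c := by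
  have hc : 0 ≤ c := (abs_nonneg _).trans (h x hx)
  have := norm_image_sub_le_of_norm_deriv_le_segment' (fun y _ => (hf y).hasDerivWithinAt)
    (fun y hy => h y (Ico_subset_Icc_self hy)) x hx
  rw [Real.norm_eq_abs, sub_zero] at this
  exact this.trans (mul_le_of_le_one_right hc hx.2)

theorem smallDoping_of_delta0_le {ρ : ℝ → ℝ} {M : ℝ} (hρ : ContDiff ℝ 4 ρ)
    (hM : 2 * delta0 ρ ≤ M) : SmallDoping (ρ 0) M ρ := by
  have h1 : ∀ x ∈ Icc (0:ℝ) 1, |deriv ρ x| ≤ M := fun x hx => by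
    simpa only [zero_add, iteratedDeriv_one] using
      (abs_iteratedDeriv_le_delta0 hρ zero_le_two hx).trans hM
  refine fun x hx => ⟨abs_sub_zero_le_of_hasDerivAt
    (fun y => (hρ.differentiable (by norm_num) y).hasDerivAt) h1 hx, h1 x hx,
    (abs_iteratedDeriv_le_delta0 hρ one_le_two hx).trans hM,
    (abs_iteratedDeriv_le_delta0 hρ le_rfl hx).trans hM⟩

/-- Integrating the momentum balance over `(0,1)` controls the boundary current. -/
theorem IsSteadyPerturbSol.abs_current_le {ν ε τ lam μ Jb Vb ρb k : ℝ} {ρ p q r V : ℝ → ℝ}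
    (hρ : ContDiff ℝ 4 ρ) (hρ01 : ρ 0 = ρ 1) (h : IsSteadyPerturbSol ν ε τ lam μ Jb Vb ρ p q r V)
    (hk : ∀ x ∈ Icc (0:ℝ) 1, |-(ν + ε ^ 2 / (18 * ν)) * (ν * iteratedDeriv 3 p x)
      + ν * deriv p x / τ + μ * deriv p x + 2 / 3 * deriv r x - ρb * deriv V x + Jb / τ
      + (1 + μ) * deriv ρ x| ≤ k) : |Jb / τ - ρb * Vb| ≤ k := by
  have hp := (h.bc_p 0 (by norm_num))
  have hp2 := (h.bc_p 2 (by norm_num))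
  simp only [iteratedDeriv_zero] at hp
  have H := abs_sub_zero_le_of_hasDerivAt
    (f := fun x => -(ν + ε ^ 2 / (18 * ν)) * (ν * iteratedDeriv 2 p x) + ν * p x / τ + μ * p x
      + 2 / 3 * r x - ρb * V x + Jb / τ * x + (1 + μ) * ρ x) (fun x => ?_) hk
    (right_mem_Icc.mpr zero_le_one)
  · simpa [hp.1, hp.2, hp2.1, hp2.2, h.bc_r.1, h.bc_r.2, h.bc_V.2.2.1, h.bc_V.2.2.2, hρ01,
      neg_add_eq_sub] using H
  · have dp := (h.reg_p.differentiable (by norm_num) x).hasDerivAt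
    have dr := (h.reg_r.differentiable (by norm_num) x).hasDerivAt
    have dV := (h.reg_V.differentiable (by norm_num) x).hasDerivAt
    have dρ := (hρ.differentiable (by norm_num) x).hasDerivAt
    have d3 := hasDerivAt_iteratedDeriv h.reg_p (k := 2) (by norm_num) x
    have dx : HasDerivAt (fun x : ℝ => Jb / τ * x) (Jb / τ) x := by
      simpa using (hasDerivAt_id x).const_mul (Jb / τ)
    exact (((((((d3.const_mul ν).const_mul _).add ((dp.const_mul ν).div_const τ)).add
      (dp.const_mul μ)).add (dr.const_mul _)).sub (dV.const_mul ρb)).add dx).add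
      (dρ.const_mul _)

theorem IsSteadyPerturbSol.iteratedDeriv_potential {ν ε τ lam μ Jb Vb : ℝ} {ρ p q r V : ℝ → ℝ}
    (hlam : 0 < lam) (h : IsSteadyPerturbSol ν ε τ lam μ Jb Vb ρ p q r V) {k : ℕ} (hk : k ≤ 3) :
    EqOn (iteratedDeriv (k + 2) V) (fun x => iteratedDeriv k p x / lam ^ 2) (Icc 0 1) := by
  induction k with
  | zero =>
    intro x hx
    have := h.eq4 x hx
    simp only [zero_add, iteratedDeriv_zero]
    rw [eq_div_iff (by positivity)]
    linarith
  | succ k ih =>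
    have hV : Differentiable ℝ (iteratedDeriv (k + 2) V) :=
      h.reg_V.differentiable_iteratedDeriv _ (by exact_mod_cast (by omega : k + 2 < 5))
    have hp : Differentiable ℝ (iteratedDeriv k p) :=
      h.reg_p.differentiable_iteratedDeriv _ (by exact_mod_cast (by omega : k < 3))
    intro x hx
    have := deriv_eqOn_Icc hV (hp.div_const _) (ih (by omega)) hx
    rw [deriv_div_const] at this
    change iteratedDeriv (k + 2 + 1) V x = iteratedDeriv (k + 1) p x / lam ^ 2
    rwa [iteratedDeriv_succ, iteratedDeriv_succ (n := k)]

theorem IsSteadyPerturbSol.sobSq_sum_le {ν ε τ lam μ Jb Vb c ρb : ℝ} {ρ p q r V : ℝ → ℝ}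
    (hν : 0 < ν) (hlam : 0 < lam) (h : IsSteadyPerturbSol ν ε τ lam μ Jb Vb ρ p q r V)
    (hc : ∀ x ∈ Icc (0:ℝ) 1, SmallJet ρb Jb c ρ p V x ∧ |r x| ≤ c ∧ |deriv r x| ≤ c ∧
      |iteratedDeriv 3 p x| ≤ c ∧ |iteratedDeriv 2 r x| ≤ c) :
    sobSq 3 p + sobSq 2 q + sobSq 2 r + sobSq 5 V
      ≤ (7 + 3 * ν ^ 2 + 6 * (1 + 1 / lam ^ 2) ^ 2) * c ^ 2 := by
  have hc0 : 0 ≤ c := (hc 0 (left_mem_Icc.mpr zero_le_one)).1.nonneg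
  have hp : ∀ i ≤ 3, ∀ x ∈ Icc (0:ℝ) 1, |iteratedDeriv i p x| ≤ c := by
    intro i hi x hx
    obtain ⟨hs, -, -, hp3, -⟩ := hc x hx
    interval_cases i
    · simpa using hs.p0
    · simpa using hs.p1
    · exact hs.p2
    · exact hp3
  have hq : ∀ i ≤ 2, ∀ x ∈ Icc (0:ℝ) 1, |iteratedDeriv i q x| ≤ ν * c := by
    intro i hi x hx
    obtain ⟨h0, h1, h2⟩ := h.flux_eq hx
    have : iteratedDeriv i q x = ν * iteratedDeriv (i + 1) p x := by
      interval_cases i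
      · simpa using h0
      · simpa using h1
      · exact h2
    rw [this, abs_mul, abs_of_pos hν]
    exact mul_le_mul_of_nonneg_left (hp _ (by omega) x hx) hν.le
  have hr : ∀ i ≤ 2, ∀ x ∈ Icc (0:ℝ) 1, |iteratedDeriv i r x| ≤ c := by
    intro i hi x hx
    obtain ⟨-, h0, h1, -, h2⟩ := hc x hx
    interval_cases i
    · simpa using h0
    · simpa using h1
    · exact h2
  have hV : ∀ i ≤ 5, ∀ x ∈ Icc (0:ℝ) 1, |iteratedDeriv i V x| ≤ (1 + 1 / lam ^ 2) * c := by
    have hle : c ≤ (1 + 1 / lam ^ 2) * c :=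
      le_mul_of_one_le_left hc0 (le_add_of_nonneg_right (by positivity))
    intro i hi x hx
    match i with
    | 0 =>
      have := abs_sub_zero_le_of_hasDerivAt
        (fun y => (h.reg_V.differentiable (by norm_num) y).hasDerivAt)
        (fun y hy => (hc y hy).1.v) hx
      rw [h.bc_V.2.2.1, sub_zero] at this
      simpa using this.trans hle
    | 1 => simpa using (hc x hx).1.v.trans hle
    | k + 2 =>
      rw [h.iteratedDeriv_potential hlam (by omega : k ≤ 3) hx, abs_div,
        abs_of_pos (by positivity : 0 < lam ^ 2)]
      calc |iteratedDeriv k p x| / lam ^ 2 ≤ c / lam ^ 2 := by gcongr; exact hp k (by omega) x hx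
        _ ≤ (1 + 1 / lam ^ 2) * c := by rw [add_mul, one_mul, one_div_mul_eq_div]; linarith
  have := sobSq_le_of_abs_le hp
  have := sobSq_le_of_abs_le hq
  have := sobSq_le_of_abs_le hr
  have := sobSq_le_of_abs_le hV
  norm_num [mul_pow] at *
  linarith

/-- estimate (2.14): full a-priori estimate for solutions of the
steady-state perturbation system, for `J_b` and `δ₀` sufficiently small. -/
theorem steady_perturbation_full_estimate
    (ν ε τ lam μ Vb ρb : ℝ) (hν : 0 < ν) (hε : 0 < ε) (hτ : 0 < τ)
    (hlam : 0 < lam) (hμ : 0 < μ) (hρb : 0 < ρb) :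
    ∃ C0 > (0:ℝ), ∃ η > (0:ℝ),
      ∀ (ρ : ℝ → ℝ) (Jb : ℝ) (p q r V : ℝ → ℝ),
        AssumpA1 ρ → ρ 0 = ρb → AssumpA2 ν τ lam μ ρ →
        |Jb| ≤ η → delta0 ρ ≤ η →
        IsSteadyPerturbSol ν ε τ lam μ Jb Vb ρ p q r V →
        sobSq 3 p + sobSq 2 q + sobSq 2 r + sobSq 5 V ≤ C0 * (delta0 ρ) ^ 2 := by
  obtain ⟨C, hC, M₀, hM₀, hsol⟩ := exists_solution_bound ν ε hν hτ hlam hμ hρb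
  obtain ⟨K, hK, hmom⟩ := exists_momentum_bound ν ε τ lam μ hν hρb
  have hsmall : ∀ᶠ η in nhdsWithin (0:ℝ) (Ioi 0), 0 < η ∧ 3 * η ≤ M₀ ∧
      2 * (τ * K * C ^ 2) * (3 * η) ≤ 1 ∧ (Vb ≠ 0 → C * (3 * η) < |Vb|) := by
    have hev : ∀ a b : ℝ, 0 < b → ∀ᶠ η in nhdsWithin (0:ℝ) (Ioi 0), a * (3 * η) < b := by
      intro a b hb
      have hcont : Continuous fun η : ℝ => a * (3 * η) := by fun_prop
      have := hcont.tendsto 0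
      simp only [mul_zero] at this
      exact nhdsWithin_le_nhds (this.eventually_lt_const hb)
    have hVb : ∀ᶠ η in nhdsWithin (0:ℝ) (Ioi 0), Vb ≠ 0 → C * (3 * η) < |Vb| := by
      by_cases hV : Vb = 0
      · simp [hV]
      · filter_upwards [hev C |Vb| (abs_pos.mpr hV)] with η hη _ using hη
    filter_upwards [self_mem_nhdsWithin, hev 1 M₀ hM₀, hev (2 * (τ * K * C ^ 2)) 1 one_pos, hVb]
      with η h1 h2 h3 h4 using ⟨h1, by linarith, h3.le, h4⟩
  obtain ⟨η, hη, hηM, hηK, hηV⟩ := hsmall.exists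
  refine ⟨(7 + 3 * ν ^ 2 + 6 * (1 + 1 / lam ^ 2) ^ 2) * (4 * C) ^ 2, by positivity, η, hη, ?_⟩
  rintro ρ Jb p q r V ⟨hρ01, hρ, -⟩ rfl - hJ hδ h
  have hδ0 : 0 ≤ delta0 ρ := Real.sqrt_nonneg _
  set M := |Jb| + 2 * delta0 ρ with hM
  have hM0 : 0 ≤ M := by positivity
  have hMη : M ≤ 3 * η := by linarith
  obtain ⟨hCM1, hCM4, hjet⟩ := hsol Vb Jb M ρ p q r V hρ h (hMη.trans hηM) (by linarith)
    (smallDoping_of_delta0_le hρ (le_add_of_nonneg_left (abs_nonneg _)))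
  have hVb : Vb = 0 := by
    by_contra hne
    have := abs_sub_zero_le_of_hasDerivAt
      (fun y => (h.reg_V.differentiable (by norm_num) y).hasDerivAt)
      (fun y hy => (hjet y hy).1.v) (right_mem_Icc.mpr zero_le_one)
    rw [h.bc_V.2.2.1, h.bc_V.2.2.2, sub_zero] at this
    exact absurd (this.trans (mul_le_mul_of_nonneg_left hMη hC.le)) (not_le.mpr (hηV hne))
  have hcur := h.abs_current_le hρ hρ01 fun x hx =>
    hmom Vb Jb (C * M) ρ p q r V x hρ h hx hCM1 hCM4 (hjet x hx).1
  rw [hVb, mul_zero, sub_zero, abs_div, abs_of_pos hτ, div_le_iff₀ hτ] at hcur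
  have hM4 : M ≤ 4 * delta0 ρ := by
    have hX : 2 * (τ * K * C ^ 2) * M ≤ 1 :=
      (mul_le_mul_of_nonneg_left hMη (by positivity)).trans hηK
    have : 2 * (K * (C * M) ^ 2 * τ) ≤ M := by
      calc 2 * (K * (C * M) ^ 2 * τ) = 2 * (τ * K * C ^ 2) * M * M := by ring
        _ ≤ M := mul_le_of_le_one_left hM0 hX
    linarith
  refine (h.sobSq_sum_le hν hlam hjet).trans ?_
  rw [mul_assoc, ← mul_pow]
  refine mul_le_mul_of_nonneg_left (pow_le_pow_left₀ (by positivity) ?_ 2) (by positivity)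
  linarith [mul_le_mul_of_nonneg_left hM4 hC.le]
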